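/- The group G_{Ω₀} = {g invertible linear endomorphism of ℝ⁷ : Ω₀(gX,gY,gZ) = Ω₀(X,Y,Z) for all X,Y,Z} acts transitively on the pseudohyperbolic space {Y ∈ ℝ⁷ : n(Y) = −1}: for every Y ∈ ℝ⁷ with n(Y) = −1 there exists g ∈ G_{Ω₀} with g(1,0,0) = Y (note that the element (1,0,0) satisfies n(1,0,0) = −1). -/

import Mathlib

open Matrix

noncomputable section

/-- `ℝ⁷`, identified with `ℝ × ℝ³ × ℝ³`, elements written `(s, u, v)`. -/
abbrev V7 := ℝ × (Fin 3 → ℝ) × (Fin 3 → ℝ)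

/-- The quadratic form `n(s,u,v) = -s² - 4 uᵀv` on `ℝ⁷`, of signature `(4,3)`. -/
def nq (X : V7) : ℝ := -X.1 ^ 2 - 4 * (X.2.1 ⬝ᵥ X.2.2)

/-- The symmetric bilinear form associated to `n` by polarization. -/
def nb (X Y : V7) : ℝ := (nq (X + Y) - nq X - nq Y) / 2

/-- The bilinear product `×` on `ℝ⁷`. -/
def cr (X Y : V7) : V7 :=
  (2 * (X.2.1 ⬝ᵥ Y.2.2) - 2 * (X.2.2 ⬝ᵥ Y.2.1),
   X.1 • Y.2.1 - Y.1 • X.2.1 - (2 : ℝ) • (crossProduct X.2.2 Y.2.2),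
   -(X.1 • Y.2.2) + Y.1 • X.2.2 + (2 : ℝ) • (crossProduct X.2.1 Y.2.1))

/-- The alternating 3-form `Ω₀(X,Y,Z) = n(X × Y, Z)` on `ℝ⁷`. -/
def Omega0 (X Y Z : V7) : ℝ := nb (cr X Y) Z

/-- The invertible linear maps of `V7` preserving the 3-form `Ω₀`. -/
def PreservesOmega0 (g : V7 ≃ₗ[ℝ] V7) : Prop :=
  ∀ A B C : V7, Omega0 (g A) (g B) (g C) = Omega0 A B C

lemma PreservesOmega0.trans {g h : V7 ≃ₗ[ℝ] V7} (hg : PreservesOmega0 g)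
    (hh : PreservesOmega0 h) : PreservesOmega0 (g.trans h) := fun A B C => by
  simp only [LinearEquiv.trans_apply, hh _ _ _, hg _ _ _]

lemma nb_eq (X Y : V7) :
    nb X Y = -(X.1 * Y.1) - 2 * (X.2.1 ⬝ᵥ Y.2.2 + X.2.2 ⬝ᵥ Y.2.1) := by
  simp only [nb, nq, Prod.fst_add, Prod.snd_add, add_dotProduct, dotProduct_add,
    dotProduct_comm X.2.2 Y.2.1]
  ring

/-- The unipotent map `(s, u, v) ↦ (s - 2 w·v, u + s w - (w·v) w, v + w × u)`. -/
def shear (w : Fin 3 → ℝ) (X : V7) : V7 :=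
  (X.1 - 2 * (w ⬝ᵥ X.2.2), X.2.1 + X.1 • w - (w ⬝ᵥ X.2.2) • w,
    X.2.2 + crossProduct w X.2.1)

lemma shear_neg_shear (w : Fin 3 → ℝ) (X : V7) : shear (-w) (shear w X) = X := by
  obtain ⟨s, u, v⟩ := X
  refine Prod.ext ?_ (Prod.ext ?_ ?_)
  · simp [shear]
  · simp only [shear, dotProduct_add, neg_dotProduct, dot_self_cross]
    module
  · simp [shear, add_assoc, cross_anticomm']

/-- `shear w` as a linear automorphism, with inverse `shear (-w)`. -/
def shearEquiv (w : Fin 3 → ℝ) : V7 ≃ₗ[ℝ] V7 where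
  toFun := shear w
  invFun := shear (-w)
  map_add' X Y := by
    refine Prod.ext ?_ (Prod.ext ?_ ?_) <;>
      simp only [shear, Prod.fst_add, Prod.snd_add, dotProduct_add, map_add]
    · ring
    · module
    · module
  map_smul' c X := by
    refine Prod.ext ?_ (Prod.ext ?_ ?_) <;>
      simp only [shear, Prod.smul_fst, Prod.smul_snd, dotProduct_smul, map_smul, smul_eq_mul,
        RingHom.id_apply]
    · ring
    · module
    · module
  left_inv := shear_neg_shear w
  right_inv X := by simpa using shear_neg_shear (-w) X

/-- The involution `(s, u, v) ↦ (-s, -v, -u)`. -/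
def swapNeg : V7 ≃ₗ[ℝ] V7 where
  toFun X := (-X.1, -X.2.2, -X.2.1)
  invFun X := (-X.1, -X.2.2, -X.2.1)
  map_add' X Y := by simp [add_comm]
  map_smul' c X := by simp
  left_inv X := by simp
  right_inv X := by simp

lemma swapNeg_apply (X : V7) : swapNeg X = (-X.1, -X.2.2, -X.2.1) := rfl

lemma shearEquiv_apply (w : Fin 3 → ℝ) (X : V7) : shearEquiv w X = shear w X := rfl

lemma preservesOmega0_swapNeg : PreservesOmega0 swapNeg := by
  rintro ⟨r, a, b⟩ ⟨s, c, d⟩ ⟨t, e, f⟩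
  simp [swapNeg_apply, Omega0, nb_eq, cr, cross_apply, vec3_dotProduct]
  ring

lemma preservesOmega0_shearEquiv (w : Fin 3 → ℝ) : PreservesOmega0 (shearEquiv w) := by
  rintro ⟨r, a, b⟩ ⟨s, c, d⟩ ⟨t, e, f⟩
  simp only [shearEquiv_apply, shear, Omega0, nb_eq, cr, cross_apply, vec3_dotProduct,
    Pi.add_apply, Pi.sub_apply, Pi.neg_apply, Pi.smul_apply, smul_eq_mul, cons_val]
  ring

/-- Two shears move `(1, 0, 0)` to any point with `n = -1` off the hyperplane `s = -1`. -/
lemma exists_preservesOmega0_apply_eq {Y : V7} (hY : nq Y = -1) (hs : Y.1 ≠ -1) :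
    ∃ g : V7 ≃ₗ[ℝ] V7, PreservesOmega0 g ∧ g ((1, 0, 0) : V7) = Y := by
  obtain ⟨s, u, v⟩ := Y
  have hs' : 1 + s ≠ 0 := fun h => hs (by simpa using eq_neg_of_add_eq_zero_right h)
  have huv : v ⬝ᵥ u = (1 + s) * (1 - s) / 4 := by
    simp only [nq] at hY
    rw [dotProduct_comm]
    linarith
  have hk : ((2 / (1 + s)) • v) ⬝ᵥ u = (1 - s) / 2 := by
    rw [smul_dotProduct, huv, smul_eq_mul]
    field_simp
    ring
  refine ⟨(((shearEquiv u).trans swapNeg).trans (shearEquiv ((2 / (1 + s)) • v))).trans swapNeg,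
    (((preservesOmega0_shearEquiv _).trans preservesOmega0_swapNeg).trans
      (preservesOmega0_shearEquiv _)).trans preservesOmega0_swapNeg, ?_⟩
  simp only [LinearEquiv.trans_apply, swapNeg_apply, shearEquiv_apply, shear, dotProduct_zero,
    map_zero, dotProduct_neg, one_smul, zero_smul, zero_add, sub_zero, mul_zero, hk]
  refine Prod.ext ?_ (Prod.ext ?_ ?_)
  · simp only []
    ring
  · simp
  · simp only [neg_zero, zero_add, smul_smul, ← sub_smul,
      ← neg_smul]
    convert one_smul ℝ v using 2
    field_simp
    ring

/-- the element `(1,0,0)` satisfies `n(1,0,0) = -1`, and the group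
`G_{Ω₀}` of invertible linear maps preserving `Ω₀` acts transitively on the
pseudohyperbolic space `{Y ∈ ℝ⁷ : n(Y) = -1}`: every such `Y` is `g(1,0,0)` for
some `g ∈ G_{Ω₀}`. -/
theorem stmt14 :
    nq ((1, 0, 0) : V7) = -1 ∧
    ∀ Y : V7, nq Y = -1 →
      ∃ g : V7 ≃ₗ[ℝ] V7,
        (∀ A B C : V7, Omega0 (g A) (g B) (g C) = Omega0 A B C) ∧
        g ((1, 0, 0) : V7) = Y := by
  refine ⟨by simp [nq], fun Y hY => ?_⟩
  by_cases hs : Y.1 = -1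
  · have hn : nq (swapNeg Y) = -1 := by
      simpa [nq, swapNeg_apply, dotProduct_comm] using hY
    obtain ⟨g, hg, hgY⟩ := exists_preservesOmega0_apply_eq hn (by
      rw [swapNeg_apply, hs]
      norm_num)
    refine ⟨g.trans swapNeg, hg.trans preservesOmega0_swapNeg, ?_⟩
    rw [LinearEquiv.trans_apply, hgY]
    simp [swapNeg_apply]
  · exact exists_preservesOmega0_apply_eq hY hs
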